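/- arXiv:1703.01890 — 2 statements merged into one kernel-verified Lean document; each statement's English description precedes it below -/
import Mathlib

section
/- Let R be a commutative ring of characteristic zero (e.g. a finitely generated algebra over a field of characteristic 0) and let ξ : R → R be a derivation. If an ideal I ⊆ R satisfies ξ(I) ⊆ I, then the radical √I also satisfies ξ(√I) ⊆ √I. -/
theorem aux_pow_mem {R : Type*} [CommRing R] [Algebra ℚ R]
    (ξ : Derivation ℚ R R) (I : Ideal R) (hI : ∀ x ∈ I, ξ x ∈ I) (f : R) (m : ℕ) :
    ∀ k : ℕ, f ^ m * ξ f ^ k ∈ I → ∃ j : ℕ, ξ f ^ j ∈ I := by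
  induction m with
  | zero => intro k h; exact ⟨k, by simpa using h⟩
  | succ m ih =>
    intro k h
    apply ih (k + 2)
    have h1 := I.mul_mem_left (ξ f) (hI _ h)
    have h2 := I.mul_mem_left ((k : R) * ξ (ξ f)) h
    have h3 := I.sub_mem h1 h2
    have e : ξ f * ξ (f ^ (m + 1) * ξ f ^ k) - (k : R) * ξ (ξ f) * (f ^ (m + 1) * ξ f ^ k)
        = ((m : R) + 1) * (f ^ m * ξ f ^ (k + 2)) := by
      rw [Derivation.leibniz, Derivation.leibniz_pow, Derivation.leibniz_pow]
      simp only [smul_eq_mul, nsmul_eq_mul, Nat.add_sub_cancel]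
      cases k with
      | zero => push_cast; ring
      | succ k => simp only [Nat.add_sub_cancel]; push_cast; ring
    rw [e] at h3
    have h4 := I.mul_mem_left (algebraMap ℚ R ((m : ℚ) + 1)⁻¹) h3
    have e2 : algebraMap ℚ R ((m : ℚ) + 1)⁻¹ * ((m : R) + 1) = 1 := by
      have : ((m : R) + 1) = algebraMap ℚ R ((m : ℚ) + 1) := by simp
      rw [this, ← map_mul, inv_mul_cancel₀ (by positivity), map_one]
    rwa [← mul_assoc, e2, one_mul] at h4

/-- If a derivation of a commutative ℚ-algebra preserves an ideal `I`,
then it preserves the radical `√I`. -/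
theorem derivation_preserves_radical {R : Type*} [CommRing R] [Algebra ℚ R]
    (ξ : Derivation ℚ R R) (I : Ideal R) (hI : ∀ x ∈ I, ξ x ∈ I) :
    ∀ x ∈ I.radical, ξ x ∈ I.radical := by
  rintro x ⟨n, hn⟩
  exact aux_pow_mem ξ I hI x n 0 (by simpa using hn)
end

section
/- For d = 2m even and r < d even, the r-th transvectant of f = x^{m−1}y^{m+1} with itself, (f,f)_r = Σ_{i=0}^{r} (−1)^i C(r,i) (∂^r f/∂x^{r−i}∂y^i)(∂^r f/∂x^i∂y^{r−i}), is a nonzero scalar multiple of x^{d−r−2} y^{d−r+2}. -/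
open MvPolynomial Finset

/-- Iterated partial derivative `∂^{a+b} f / ∂x^a ∂y^b` of a binary form. -/
noncomputable def dxy (a b : ℕ) (f : MvPolynomial (Fin 2) ℚ) : MvPolynomial (Fin 2) ℚ :=
  (⇑(MvPolynomial.pderiv (0 : Fin 2)))^[a] ((⇑(MvPolynomial.pderiv (1 : Fin 2)))^[b] f)

lemma pderiv_iter0 (a p : ℕ) (c : ℚ) (g : MvPolynomial (Fin 2) ℚ)
    (hg : pderiv (0 : Fin 2) g = 0) :
    (⇑(pderiv (0 : Fin 2)))^[a] (C c * X 0 ^ p * g)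
      = C (c * (p.descFactorial a : ℚ)) * X 0 ^ (p - a) * g := by
  induction a with
  | zero => simp
  | succ a ih =>
    rw [Function.iterate_succ_apply', ih]
    rw [Nat.descFactorial_succ]
    simp only [Derivation.leibniz, Derivation.leibniz_pow, hg, pderiv_C, pderiv_X_self, smul_eq_mul,
      nsmul_eq_mul, Nat.cast_mul, map_mul, map_natCast, Derivation.map_natCast, mul_zero, zero_add, add_zero, mul_one]
    rw [show p - (a + 1) = p - a - 1 by omega]
    ring

lemma pderiv_iter1 (a p : ℕ) (g : MvPolynomial (Fin 2) ℚ)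
    (hg : pderiv (1 : Fin 2) g = 0) :
    (⇑(pderiv (1 : Fin 2)))^[a] (g * X 1 ^ p)
      = C (p.descFactorial a : ℚ) * g * X 1 ^ (p - a) := by
  induction a with
  | zero => simp
  | succ a ih =>
    rw [Function.iterate_succ_apply', ih]
    rw [Nat.descFactorial_succ]
    simp only [Derivation.leibniz, Derivation.leibniz_pow, hg, pderiv_C, pderiv_X_self, smul_eq_mul,
      nsmul_eq_mul, Nat.cast_mul, map_mul, map_natCast, Derivation.map_natCast, mul_zero, zero_add, add_zero, mul_one]
    rw [show p - (a + 1) = p - a - 1 by omega]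
    ring

lemma dxy_monomial (a b p q : ℕ) :
    dxy a b (X 0 ^ p * X 1 ^ q) =
      C ((q.descFactorial b : ℚ) * (p.descFactorial a : ℚ)) * X 0 ^ (p - a) * X 1 ^ (q - b) := by
  unfold dxy
  rw [pderiv_iter1, pderiv_iter0]
  · simp [Derivation.leibniz_pow, pderiv_X]
  · simp [Derivation.leibniz_pow, pderiv_X]

/-- The summand. -/
def tU (r a b i : ℕ) : ℚ :=
  (-1) ^ i * (r.choose i : ℚ) * ((a.descFactorial i : ℚ) * (a.descFactorial (r - i) : ℚ) *
    ((b.descFactorial i : ℚ) * (b.descFactorial (r - i) : ℚ)))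

lemma dF_succ (n k : ℕ) :
    (n.descFactorial (k + 1) : ℚ) = ((n : ℚ) - k) * n.descFactorial k := by
  rw [Nat.descFactorial_succ]
  rcases le_or_gt k n with h | h
  · push_cast [h]; ring
  · simp [Nat.descFactorial_eq_zero_iff_lt.mpr h]

lemma tU_step (r a b i : ℕ) (hi : i ≤ r) :
    ((i : ℚ) + 1) * ((a : ℚ) - r + i + 1) * ((b : ℚ) - r + i + 1) * tU r a b (i + 1) =
      -(((r : ℚ) - i) * ((a : ℚ) - i) * ((b : ℚ) - i) * tU r a b i) := by
  rcases hi.eq_or_lt with rfl | hi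
  · simp [tU]
  obtain ⟨k, rfl⟩ : ∃ k, r = i + 1 + k := ⟨r - (i + 1), by omega⟩
  have hc : ((i + 1 + k).choose (i + 1) : ℚ) * ((i : ℚ) + 1) =
      ((i + 1 + k).choose i : ℚ) * (k + 1) := by
    have := Nat.choose_succ_right_eq (i + 1 + k) i
    rw [show i + 1 + k - i = k + 1 by omega] at this
    exact_mod_cast this
  unfold tU
  rw [show i + 1 + k - i = k + 1 by omega, show i + 1 + k - (i + 1) = k by omega]
  simp only [dF_succ, pow_succ]
  push_cast
  linear_combination (-(-1) ^ i * ((a : ℚ) - k) * ((b : ℚ) - k) *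
    (((a : ℚ) - i) * a.descFactorial i * a.descFactorial k *
     (((b : ℚ) - i) * b.descFactorial i * b.descFactorial k))) * hc

lemma tU_shift (r a b i : ℕ) (hi : i ≤ r) :
    ((a : ℚ) + 1) ^ 2 * tU r a b i =
      ((a : ℚ) + 1 - i) * ((a : ℚ) + 1 - r + i) * tU r (a + 1) b i := by
  have h : ∀ k : ℕ, ((a : ℚ) + 1) * a.descFactorial k
      = ((a : ℚ) + 1 - k) * (a + 1).descFactorial k := by
    intro k
    have h1 := dF_succ (a + 1) k
    rw [Nat.succ_descFactorial_succ] at h1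
    push_cast at h1
    exact h1
  have h1 := h i
  have h2 := h (r - i)
  rw [Nat.cast_sub hi] at h2
  unfold tU
  calc _ = (-1) ^ i * (r.choose i : ℚ) * ((((a : ℚ) + 1) * a.descFactorial i) *
        (((a : ℚ) + 1) * a.descFactorial (r - i)) *
        ((b.descFactorial i : ℚ) * (b.descFactorial (r - i) : ℚ))) := by ring
    _ = _ := by rw [h1, h2]; ring

lemma sum_rec (s a b : ℕ) :
    ((a : ℚ) + 1 - s) * ((a : ℚ) + 1 + b - 2 * s) *
        ∑ i ∈ range (2 * s + 1), tU (2 * s) (a + 1) b i =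
      ((a : ℚ) + 1 + b - s) * (a + 1) * ∑ i ∈ range (2 * s + 1), tU (2 * s) a b i := by
  have ha : (a : ℚ) + 1 ≠ 0 := by positivity
  apply mul_left_cancel₀ ha
  rw [← sub_eq_zero]
  let G : ℕ → ℚ := fun i => -(1 / 2) * (i * ((a : ℚ) + 1 - 2 * s + i) * ((b : ℚ) - 2 * s + i) *
    tU (2 * s) (a + 1) b i)
  have key : ∀ i ∈ range (2 * s + 1),
      ((a : ℚ) + 1) * (((a : ℚ) + 1 - s) * ((a : ℚ) + 1 + b - 2 * s)) * tU (2 * s) (a + 1) b i -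
      ((a : ℚ) + 1) * (((a : ℚ) + 1 + b - s) * (a + 1)) * tU (2 * s) a b i = G (i + 1) - G i := by
    intro i hi
    have hi' : i ≤ 2 * s := by simpa [Nat.lt_succ_iff] using hi
    have h1 := tU_shift (2 * s) a b i hi'
    have h2 := tU_step (2 * s) (a + 1) b i hi'
    simp only [G]
    push_cast at h1 h2 ⊢
    linear_combination (-((a : ℚ) + 1 + b - s)) * h1 + (1 / 2) * h2
  have := Finset.sum_congr rfl key
  rw [Finset.sum_range_sub, Finset.sum_sub_distrib, ← Finset.mul_sum, ← Finset.mul_sum] at this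
  have hG : G (2 * s + 1) - G 0 = 0 := by simp [G, tU]
  rw [hG] at this
  linear_combination this

lemma sum_ne (s a b : ℕ) (ha : s ≤ a) (hb : s ≤ b) :
    ∑ i ∈ range (2 * s + 1), tU (2 * s) a b i ≠ 0 := by
  induction a, ha using Nat.le_induction with
  | base =>
    rw [Finset.sum_eq_single s]
    · unfold tU
      rw [show 2 * s - s = s by omega]
      have h1 : (s.descFactorial s : ℚ) ≠ 0 := by
        simp [Nat.descFactorial_eq_zero_iff_lt]
      have h2 : (b.descFactorial s : ℚ) ≠ 0 := by
        simpa [Nat.descFactorial_eq_zero_iff_lt] using hb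
      have h3 : ((2 * s).choose s : ℚ) ≠ 0 := by
        exact_mod_cast (Nat.choose_pos (by omega)).ne'
      have h4 : ((-1 : ℚ)) ^ s ≠ 0 := by simp
      exact mul_ne_zero (mul_ne_zero h4 h3)
        (mul_ne_zero (mul_ne_zero h1 h1) (mul_ne_zero h2 h2))
    · intro i hi hne
      unfold tU
      rcases lt_or_gt_of_ne hne with h | h
      · rw [Nat.descFactorial_eq_zero_iff_lt.mpr (show s < 2 * s - i by omega)]; simp
      · rw [Nat.descFactorial_eq_zero_iff_lt.mpr h]; simp
    · intro h; exact absurd (Finset.mem_range.mpr (by omega)) h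
  | succ a ha ih =>
    intro h0
    have h := sum_rec s a b
    rw [h0, mul_zero] at h
    have ha' : (s : ℚ) ≤ a := by exact_mod_cast ha
    have hb' : (s : ℚ) ≤ b := by exact_mod_cast hb
    have p1 : (0 : ℚ) < (a : ℚ) + 1 + b - s := by
      have : (0 : ℚ) ≤ b := by positivity
      linarith
    have p2 : (0 : ℚ) < (a : ℚ) + 1 := by positivity
    exact mul_ne_zero (mul_pos p1 p2).ne' ih h.symm

/-- For `d = 2m` and even `r < d`, the `r`-th transvectant of `f = x^{m-1} y^{m+1}` with
itself is a nonzero scalar multiple of `x^{d-r-2} y^{d-r+2}`. -/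
theorem transvectant_of_xm1ym1_nonzero (m s r : ℕ) (hm : 1 ≤ m) (hr : r = 2 * s)
    (hrd : r < 2 * m) :
    ∃ c : ℚ, c ≠ 0 ∧
      (∑ i ∈ Finset.range (r + 1), ((-1 : ℚ) ^ i * (r.choose i : ℚ)) •
          (dxy (r - i) i (X 0 ^ (m - 1) * X 1 ^ (m + 1)) *
            dxy i (r - i) (X 0 ^ (m - 1) * X 1 ^ (m + 1)))) =
        MvPolynomial.C c * X 0 ^ (2 * m - r - 2) * X 1 ^ (2 * m - r + 2) := by
  subst hr
  refine ⟨∑ i ∈ range (2 * s + 1), tU (2 * s) (m - 1) (m + 1) i,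
    sum_ne s (m - 1) (m + 1) (by omega) (by omega), ?_⟩
  rw [map_sum, Finset.sum_mul, Finset.sum_mul]
  refine Finset.sum_congr rfl fun i hi => ?_
  have hi' : i ≤ 2 * s := by simpa [Nat.lt_succ_iff] using hi
  rw [dxy_monomial, dxy_monomial, smul_eq_C_mul]
  by_cases h1 : m - 1 < i
  · simp [tU, Nat.descFactorial_eq_zero_iff_lt.mpr h1]
  by_cases h2 : m - 1 < 2 * s - i
  · simp [tU, Nat.descFactorial_eq_zero_iff_lt.mpr h2]
  rw [show 2 * m - 2 * s - 2 = (m - 1 - (2 * s - i)) + (m - 1 - i) by omega,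
    show 2 * m - 2 * s + 2 = (m + 1 - i) + (m + 1 - (2 * s - i)) by omega, pow_add, pow_add]
  simp only [tU, map_mul]
  ring
end
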